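/- Suppose (I_1,…,I_s) satisfies the RIP. Define hat I_i as the disjoint union of I_i and 𝒥_i (the index set of the variables (x^{(i)}, ν^{(i)}), where the indices in [n] and the triples in the 𝒥_i are of two disjoint sorts). Then (hat I_1,…,hat I_s) satisfies the RIP: for every i ∈ [s−1] there exists t ≤ i such that hat I_{i+1} ∩ (hat I_1 ∪ … ∪ hat I_i) ⊆ hat I_t. -/

import Mathlib

open MvPolynomial Finset
open scoped Classical

noncomputable section

/-- Union of the earlier blocks `J 0, …, J (i-1)`. -/
def prevUnion {s : ℕ} {α : Type*} (J : Fin s → Finset α) (i : Fin s) : Finset α :=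
  (Finset.univ.filter (fun j => j < i)).biUnion J

/-- The arc relation produced by Algorithm 1: `(i, t)` is an arc iff `t < i`,
the intersection of `I i` with the union of the earlier blocks is nonempty and
contained in `I t`, and `t` is the largest such index. -/
def Arc {n s : ℕ} (I : Fin s → Finset (Fin n)) (i t : Fin s) : Prop :=
  t < i ∧ (I i ∩ prevUnion I i).Nonempty ∧ I i ∩ prevUnion I i ⊆ I t ∧
    ∀ t' : Fin s, t < t' → t' < i → ¬ I i ∩ prevUnion I i ⊆ I t'

/-- The running intersection property. -/
def RIP {n s : ℕ} (I : Fin s → Finset (Fin n)) : Prop :=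
  ∀ i : Fin s, 0 < (i : ℕ) → ∃ t : Fin s, t < i ∧ I i ∩ prevUnion I i ⊆ I t

/-- The index set `𝒥_i = {(i,t,k) : t ∈ 𝒜_i, k ∈ C_{i,t}} ∪ {(t,i,k) : t ∈ 𝒟_i, k ∈ C_{t,i}}`
of the additional variables attached to block `i`. -/
def Jset {n s : ℕ} (I : Fin s → Finset (Fin n)) (i : Fin s) :
    Finset (Fin s × Fin s × Fin n) :=
  Finset.univ.filter (fun q => (q.1 = i ∨ q.2.1 = i) ∧ Arc I q.1 q.2.1 ∧
    q.2.2 ∈ I q.1 ∩ I q.2.1)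

/-- The enlarged block `hat I_i`: the disjoint union of `I i` and `𝒥_i`
(two disjoint sorts, realized as a sum type). -/
def hatI {n s : ℕ} (I : Fin s → Finset (Fin n)) (i : Fin s) :
    Finset (Fin n ⊕ (Fin s × Fin s × Fin n)) :=
  (I i).map ⟨Sum.inl, Sum.inl_injective⟩ ∪ (Jset I i).map ⟨Sum.inr, Sum.inr_injective⟩

theorem mem_prevUnion {s : ℕ} {α : Type*} {J : Fin s → Finset α} {i : Fin s} {x : α} :
    x ∈ prevUnion J i ↔ ∃ j, j < i ∧ x ∈ J j := by
  simp [prevUnion]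

theorem inl_mem_hatI {n s : ℕ} {I : Fin s → Finset (Fin n)} {i : Fin s} {k : Fin n} :
    Sum.inl k ∈ hatI I i ↔ k ∈ I i := by
  simp [hatI]

theorem inr_mem_hatI {n s : ℕ} {I : Fin s → Finset (Fin n)} {i a b : Fin s} {k : Fin n} :
    Sum.inr (a, b, k) ∈ hatI I i ↔ (a = i ∨ b = i) ∧ Arc I a b ∧ k ∈ I a ∩ I b := by
  simp [hatI, Jset]

theorem Arc.right_unique {n s : ℕ} {I : Fin s → Finset (Fin n)} {i t u : Fin s}
    (ht : Arc I i t) (hu : Arc I i u) : t = u := by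
  rcases lt_trichotomy t u with h | h | h
  · exact absurd hu.2.2.1 (ht.2.2.2 u h hu.1)
  · exact h
  · exact absurd ht.2.2.1 (hu.2.2.2 t h ht.1)

/-- Under the RIP every non-initial block has an earlier block containing its intersection with
the preceding ones and being the target of every arc issuing from it. -/
theorem exists_parent {n s : ℕ} (I : Fin s → Finset (Fin n)) (hrip : RIP I) {i : Fin s}
    (hi : 0 < (i : ℕ)) :
    ∃ t : Fin s, t < i ∧ I i ∩ prevUnion I i ⊆ I t ∧ ∀ b, Arc I i b → b = t := by
  by_cases h : ∃ t, Arc I i t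
  · obtain ⟨t, ht⟩ := h
    exact ⟨t, ht.1, ht.2.2.1, fun b hb => hb.right_unique ht⟩
  · obtain ⟨t, hti, hIt⟩ := hrip i hi
    exact ⟨t, hti, hIt, fun b hb => absurd ⟨b, hb⟩ h⟩

/-- Lemma 4.1: if `(I_1,…,I_s)` satisfies the RIP, then so does
`(hat I_1, …, hat I_s)`, where `hat I_i` is the disjoint union of `I i` and `𝒥_i`. -/
theorem hatI_rip
    (n s : ℕ) (I : Fin s → Finset (Fin n)) (hrip : RIP I) :
    ∀ i : Fin s, 0 < (i : ℕ) →
      ∃ t : Fin s, t < i ∧ hatI I i ∩ prevUnion (hatI I) i ⊆ hatI I t := by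
  intro i hi
  obtain ⟨t, hti, hIt, harc⟩ := exists_parent I hrip hi
  refine ⟨t, hti, fun x hx => ?_⟩
  obtain ⟨hxi, hxu⟩ := Finset.mem_inter.mp hx
  obtain ⟨j, hji, hxj⟩ := mem_prevUnion.mp hxu
  rcases x with k | ⟨a, b, k⟩
  · rw [inl_mem_hatI] at hxi hxj ⊢
    exact hIt (Finset.mem_inter.mpr ⟨hxi, mem_prevUnion.mpr ⟨j, hji, hxj⟩⟩)
  · rw [inr_mem_hatI] at hxi hxj ⊢
    obtain ⟨hi', hab, hk⟩ := hxi
    obtain ⟨hj', -, -⟩ := hxj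
    have hba : b < a := hab.1
    have hai : a = i := by
      rcases hi' with h | h
      · exact h
      · subst h
        rcases hj' with h | h
        · exact absurd (h ▸ hba) hji.not_gt
        · exact absurd h hji.ne'
    subst hai
    exact ⟨Or.inr (harc b hab), hab, hk⟩
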